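/- For every n ≥ 2, the two-sided Eulerian polynomials satisfy the partial differential recurrence: n·A_n(s,t) = (n²st + (n-1)(1-s)(1-t))·A_{n-1}(s,t) + n·s·t·(1-s)·∂A_{n-1}/∂s (s,t) + n·s·t·(1-t)·∂A_{n-1}/∂t (s,t) + s·t·(1-s)·(1-t)·∂²A_{n-1}/∂s∂t (s,t). -/

import Mathlib

/-- The descent number of a permutation of `Fin n`. -/
def des {n : ℕ} (w : Equiv.Perm (Fin n)) : ℕ :=
  (Finset.univ.filter fun r : Fin n =>
    ∃ s : Fin n, (s : ℕ) = (r : ℕ) + 1 ∧ w s < w r).card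

/-- The `n`-th two-sided Eulerian polynomial
`A_n(s,t) = ∑_{w ∈ S_n} s^{des(w⁻¹)+1} t^{des(w)+1}` as a polynomial in two
variables `s = X 0`, `t = X 1`. -/
noncomputable def twoSidedEulerianPoly (n : ℕ) : MvPolynomial (Fin 2) ℤ :=
  ∑ w : Equiv.Perm (Fin n),
    (MvPolynomial.X 0 : MvPolynomial (Fin 2) ℤ) ^ (des w⁻¹ + 1) *
      (MvPolynomial.X 1 : MvPolynomial (Fin 2) ℤ) ^ (des w + 1)

open Finset

/-- The permutation of `Fin (m + 1)` obtained from `w` by inserting the value `q` at position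
`p`. -/
def insertPerm {m : ℕ} (p q : Fin (m + 1)) (w : Equiv.Perm (Fin m)) :
    Equiv.Perm (Fin (m + 1)) :=
  ((finSuccEquiv' p).trans w.optionCongr).trans (finSuccEquiv' q).symm

lemma insertPerm_self {m : ℕ} (p q : Fin (m + 1)) (w : Equiv.Perm (Fin m)) :
    insertPerm p q w p = q := by
  simp [insertPerm]

lemma insertPerm_succAbove {m : ℕ} (p q : Fin (m + 1)) (w : Equiv.Perm (Fin m)) (x : Fin m) :
    insertPerm p q w (p.succAbove x) = q.succAbove (w x) := by
  simp [insertPerm]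

lemma insertPerm_inv {m : ℕ} (p q : Fin (m + 1)) (w : Equiv.Perm (Fin m)) :
    (insertPerm p q w)⁻¹ = insertPerm q p w⁻¹ := by
  rw [inv_eq_iff_mul_eq_one]
  ext x
  rcases Fin.eq_self_or_eq_succAbove q x with rfl | ⟨y, rfl⟩
  · simp [insertPerm_self]
  · simp [insertPerm_succAbove]

lemma insertPerm_bijective {m : ℕ} (p : Fin (m + 1)) :
    Function.Bijective fun x : Fin (m + 1) × Equiv.Perm (Fin m) => insertPerm p x.1 x.2 := by
  rw [Fintype.bijective_iff_injective_and_card]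
  constructor
  · rintro ⟨q, w⟩ ⟨q', w'⟩ h
    simp only at h
    have hq : q = q' := by
      rw [← insertPerm_self p q w, h, insertPerm_self]
    subst hq
    have hw : w = w' := by
      ext x : 1
      apply Fin.succAbove_right_injective (p := q)
      rw [← insertPerm_succAbove, h, insertPerm_succAbove]
    rw [hw]
  · simp [Fintype.card_perm, Nat.factorial_succ]

/-- The one-line word of `w`, with letters and positions counted from `1`, extended by `0`. -/
def word {m : ℕ} (w : Equiv.Perm (Fin m)) (k : ℕ) : ℕ :=
  if h : 1 ≤ k ∧ k ≤ m then (w ⟨k - 1, by omega⟩ : ℕ) + 1 else 0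

lemma word_zero {m : ℕ} (w : Equiv.Perm (Fin m)) : word w 0 = 0 := by
  simp [word]

lemma word_of_lt {m : ℕ} (w : Equiv.Perm (Fin m)) {k : ℕ} (h : m < k) : word w k = 0 := by
  simp [word, h]

lemma word_succ {m : ℕ} (w : Equiv.Perm (Fin m)) (x : Fin m) :
    word w (x + 1) = (w x : ℕ) + 1 := by
  simp [word]

lemma word_le {m : ℕ} (w : Equiv.Perm (Fin m)) (k : ℕ) : word w k ≤ m := by
  unfold word
  split_ifs <;> omega

lemma word_pos {m : ℕ} (w : Equiv.Perm (Fin m)) {k : ℕ} (h1 : 1 ≤ k) (h2 : k ≤ m) :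
    1 ≤ word w k := by
  simp [word, h1, h2]

lemma word_word_inv {m : ℕ} (w : Equiv.Perm (Fin m)) {k : ℕ} (h : k ≤ m) :
    word w (word w⁻¹ k) = k := by
  rcases Nat.eq_zero_or_pos k with rfl | hk
  · simp [word_zero]
  · obtain ⟨x, rfl⟩ : ∃ x : Fin m, k = x + 1 := ⟨⟨k - 1, by omega⟩, by simp; omega⟩
    rw [word_succ, word_succ]
    simp

lemma sum_descents_word {m : ℕ} (hm : 1 ≤ m) (w : Equiv.Perm (Fin m)) :
    ∑ k ∈ range (m + 1), (if word w (k + 1) < word w k then 1 else 0 : ℤ) = des w + 1 := by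
  rw [Finset.sum_range_succ, word_of_lt w (Nat.lt_succ_self m),
    if_pos (Nat.lt_of_lt_of_le Nat.zero_lt_one (word_pos w hm le_rfl))]
  congr 1
  obtain ⟨l, rfl⟩ : ∃ l, m = l + 1 := ⟨m - 1, by omega⟩
  rw [Finset.sum_range_succ', word_zero, if_neg (Nat.not_lt_zero _), add_zero, des,
    Finset.card_filter, Fin.sum_univ_castSucc]
  push_cast
  rw [if_neg (by rintro ⟨s, hs, -⟩; have := s.2; omega), add_zero,
    ← Fin.sum_univ_eq_sum_range
      (fun k => (if word w (k + 1 + 1) < word w (k + 1) then 1 else 0 : ℤ))]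
  refine Finset.sum_congr rfl fun r _ => ?_
  have h1 := word_succ w r.castSucc
  have h2 := word_succ w r.succ
  simp only [Fin.val_castSucc, Fin.val_succ] at h1 h2
  rw [h1, h2]
  refine if_congr ?_ rfl rfl
  constructor
  · intro h
    exact ⟨r.succ, by simp, by rw [Fin.lt_def]; omega⟩
  · rintro ⟨s, hs, h⟩
    obtain rfl : s = r.succ := Fin.ext (by simpa using hs)
    rw [Fin.lt_def] at h
    omega

lemma word_insertPerm_self {m : ℕ} (p q : Fin (m + 1)) (w : Equiv.Perm (Fin m)) :
    word (insertPerm p q w) (p + 1) = q + 1 := by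
  rw [word_succ, insertPerm_self]

lemma word_insertPerm_of_le {m : ℕ} (p q : Fin (m + 1)) (w : Equiv.Perm (Fin m)) {k : ℕ}
    (h : k ≤ p) :
    word (insertPerm p q w) k = if word w k ≤ q then word w k else word w k + 1 := by
  rcases Nat.eq_zero_or_pos k with rfl | hk
  · simp [word_zero]
  · obtain ⟨x, rfl⟩ : ∃ x : Fin m, k = x + 1 := ⟨⟨k - 1, by omega⟩, by simp; omega⟩
    have hx : p.succAbove x = x.castSucc :=
      Fin.succAbove_of_castSucc_lt p x (by rw [Fin.lt_def]; simp; omega)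
    have h1 := word_succ (insertPerm p q w) (p.succAbove x)
    rw [insertPerm_succAbove, hx] at h1
    simp only [Fin.val_castSucc] at h1
    rw [h1, word_succ, Fin.succAbove]
    simp only [Fin.lt_def, Fin.val_castSucc, Nat.add_one_le_iff]
    split_ifs <;> simp

lemma word_insertPerm_of_lt {m : ℕ} (p q : Fin (m + 1)) (w : Equiv.Perm (Fin m)) {k : ℕ}
    (h : p < k) :
    word (insertPerm p q w) (k + 1) = if word w k ≤ q then word w k else word w k + 1 := by
  rcases Nat.lt_or_ge m k with hk | hk
  · simp [word_of_lt _ hk, word_of_lt _ (Nat.succ_lt_succ hk)]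
  · obtain ⟨x, rfl⟩ : ∃ x : Fin m, k = x + 1 := ⟨⟨k - 1, by omega⟩, by simp; omega⟩
    have hx : p.succAbove x = x.succ :=
      Fin.succAbove_of_le_castSucc p x (by rw [Fin.le_def]; simp; omega)
    have h1 := word_succ (insertPerm p q w) (p.succAbove x)
    rw [insertPerm_succAbove, hx] at h1
    simp only [Fin.val_succ] at h1
    rw [h1, word_succ, Fin.succAbove]
    simp only [Fin.lt_def, Fin.val_castSucc, Nat.add_one_le_iff]
    split_ifs <;> simp

/-- The indicator of the event that inserting the value `q` at position `p` does not create a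
new descent in the word `e`. -/
def keepsDescents (e : ℕ → ℕ) (p q : ℕ) : ℤ :=
  (if e (p + 1) < e p then 1 else 0) + ((if e p ≤ q then 1 else 0) -
    (if e (p + 1) ≤ q then 1 else 0))

lemma keepsDescents_eq_zero_or_one (e : ℕ → ℕ) (p q : ℕ) :
    keepsDescents e p q = 0 ∨ keepsDescents e p q = 1 := by
  unfold keepsDescents
  split_ifs <;> omega

lemma des_insertPerm {m : ℕ} (hm : 1 ≤ m) (p q : Fin (m + 1)) (w : Equiv.Perm (Fin m)) :
    (des (insertPerm p q w) : ℤ) + keepsDescents (word w) p q = des w + 1 := by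
  have h1 := sum_descents_word (Nat.succ_pos m) (insertPerm p q w)
  have h2 := sum_descents_word hm w
  obtain ⟨r, hr⟩ : ∃ r, m = p + r := ⟨m - p, by omega⟩
  rw [show m + 1 + 1 = p + (r + 2) by omega, Finset.sum_range_add, Finset.sum_range_succ',
    Finset.sum_range_succ'] at h1
  rw [show m + 1 = p + (r + 1) by omega, Finset.sum_range_add, Finset.sum_range_succ'] at h2
  have ha : ∀ k ∈ range (p : ℕ),
      (if word (insertPerm p q w) (k + 1) < word (insertPerm p q w) k then 1 else 0 : ℤ) =
        if word w (k + 1) < word w k then 1 else 0 := by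
    intro k hk
    rw [Finset.mem_range] at hk
    rw [word_insertPerm_of_le p q w (show k + 1 ≤ p from hk), word_insertPerm_of_le p q w hk.le]
    split_ifs <;> first | rfl | omega
  have hb : ∀ k ∈ range r,
      (if word (insertPerm p q w) (p + (k + 1 + 1) + 1) <
          word (insertPerm p q w) (p + (k + 1 + 1)) then 1 else 0 : ℤ) =
        if word w (p + (k + 1) + 1) < word w (p + (k + 1)) then 1 else 0 := by
    intro k _
    rw [word_insertPerm_of_lt p q w (show (p : ℕ) < p + (k + 1 + 1) by omega),
      show (p : ℕ) + (k + 1 + 1) = p + (k + 1) + 1 by omega,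
      word_insertPerm_of_lt p q w (show (p : ℕ) < p + (k + 1) by omega)]
    split_ifs <;> first | rfl | omega
  have hc := word_insertPerm_of_lt p q w (Nat.lt_succ_self p)
  rw [Finset.sum_congr rfl ha, Finset.sum_congr rfl hb] at h1
  simp only [zero_add, add_zero, Nat.succ_eq_add_one] at h1 h2 hc
  rw [hc, word_insertPerm_self, word_insertPerm_of_le p q w le_rfl] at h1
  have hd : (if (if word w (p + 1) ≤ q then word w (p + 1) else word w (p + 1) + 1) < q + 1
      then 1 else 0 : ℤ) + (if (q : ℕ) + 1 < (if word w p ≤ q then word w p else word w p + 1)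
      then 1 else 0) + keepsDescents (word w) p q =
      1 + if word w (p + 1) < word w p then 1 else 0 := by
    unfold keepsDescents
    split_ifs <;> omega
  linarith

lemma sum_keepsDescents {m : ℕ} (hm : 1 ≤ m) (w : Equiv.Perm (Fin m)) (q : ℕ) :
    ∑ p ∈ range (m + 1), keepsDescents (word w) p q = des w + 1 := by
  unfold keepsDescents
  rw [Finset.sum_add_distrib, sum_descents_word hm,
    Finset.sum_range_sub' (fun p => (if word w p ≤ q then 1 else 0 : ℤ)), word_zero,
    word_of_lt w (Nat.lt_succ_self m)]
  simp

lemma sum_crossings {m : ℕ} (w : Equiv.Perm (Fin m)) {q : ℕ} (hq : q ≤ m) :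
    ∑ p ∈ range (m + 1),
      ((if word w p ≤ q then 1 else 0) - (if word w (p + 1) ≤ q then 1 else 0) : ℤ) *
        ((if word w⁻¹ q ≤ p then 1 else 0) - (if word w⁻¹ (q + 1) ≤ p then 1 else 0)) =
      1 - if q = m then 1 else 0 := by
  set U : ℕ → ℤ := fun p => if word w p ≤ q then 1 else 0 with hU
  set V : ℕ → ℤ := fun p =>
    (if word w⁻¹ q ≤ p then 1 else 0) - (if word w⁻¹ (q + 1) ≤ p then 1 else 0) with hV
  have key : ∀ j, j ≤ m + 1 → ∑ p ∈ range (m + 1), U (p + 1) *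
      (if word w⁻¹ j = p + 1 then 1 else 0) = if 1 ≤ j ∧ j ≤ q then 1 else 0 := by
    intro j hj
    by_cases h : 1 ≤ j ∧ j ≤ m
    · have h1 := word_pos w⁻¹ h.1 h.2
      have h2 := word_le w⁻¹ j
      have h3 := word_word_inv w h.2
      rw [Finset.sum_eq_single (word w⁻¹ j - 1)]
      · rw [Nat.sub_add_cancel h1, hU]
        simp [h3, h.1]
      · intro p _ hp
        rw [if_neg (by omega), mul_zero]
      · intro hp
        simp at hp
        omega
    · have h0 : word w⁻¹ j = 0 := by simp [word, h]
      rw [if_neg (by omega)]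
      simp [h0]
  have hstep : ∀ p, (U p - U (p + 1)) * V p = (U p * V p - U (p + 1) * V (p + 1)) +
      (U (p + 1) * (if word w⁻¹ q = p + 1 then 1 else 0) -
        U (p + 1) * (if word w⁻¹ (q + 1) = p + 1 then 1 else 0)) := by
    intro p
    have : V (p + 1) = V p + (if word w⁻¹ q = p + 1 then 1 else 0) -
        (if word w⁻¹ (q + 1) = p + 1 then 1 else 0) := by
      simp only [hV]
      split_ifs <;> omega
    rw [this]
    ring
  change ∑ p ∈ range (m + 1), (U p - U (p + 1)) * V p = _
  rw [Finset.sum_congr rfl fun p _ => hstep p, Finset.sum_add_distrib,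
    Finset.sum_sub_distrib (fun p => U (p + 1) * (if word w⁻¹ q = p + 1 then 1 else 0)),
    key q (by omega), key (q + 1) (by omega), Finset.sum_range_sub' (fun p => U p * V p)]
  have hU0 : U 0 = 1 := by simp [hU, word_zero]
  have hVm : V (m + 1) = 0 := by
    have h1 := word_le w⁻¹ q
    have h2 := word_le w⁻¹ (q + 1)
    simp only [hV]
    rw [if_pos (by omega), if_pos (by omega), sub_self]
  have hV0 : V 0 = (if q = 0 then 1 else 0) - if q = m then 1 else 0 := by
    simp only [hV]
    congr 1
    · refine if_congr ⟨fun h => ?_, ?_⟩ rfl rfl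
      · by_contra hne
        have := word_pos w⁻¹ (Nat.one_le_iff_ne_zero.2 hne) hq
        omega
      · rintro rfl
        rw [word_zero]
    · refine if_congr ⟨fun h => ?_, ?_⟩ rfl rfl
      · by_contra hne
        have := word_pos w⁻¹ (show 1 ≤ q + 1 by omega) (by omega)
        omega
      · rintro rfl
        rw [word_of_lt _ (Nat.lt_succ_self q)]
  rw [hU0, hVm, hV0]
  split_ifs <;> omega

lemma sum_keepsDescents_mul {m : ℕ} (hm : 1 ≤ m) (w : Equiv.Perm (Fin m)) :
    ∑ q ∈ range (m + 1), ∑ p ∈ range (m + 1),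
      keepsDescents (word w) p q * keepsDescents (word w⁻¹) q p =
      (des w + 1) * (des w⁻¹ + 1) + m := by
  have hsplit : ∀ q ∈ range (m + 1), ∑ p ∈ range (m + 1),
      keepsDescents (word w) p q * keepsDescents (word w⁻¹) q p =
      (if word w⁻¹ (q + 1) < word w⁻¹ q then 1 else 0) * (des w + 1 : ℤ) +
      ∑ p ∈ range (m + 1), (if word w (p + 1) < word w p then 1 else 0 : ℤ) *
        ((if word w⁻¹ q ≤ p then 1 else 0) - (if word w⁻¹ (q + 1) ≤ p then 1 else 0)) +
      (1 - if q = m then 1 else 0) := by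
    intro q hq
    rw [← sum_crossings w (Nat.lt_succ_iff.1 (Finset.mem_range.1 hq)),
      ← sum_keepsDescents hm w q, Finset.mul_sum, ← Finset.sum_add_distrib,
      ← Finset.sum_add_distrib]
    refine Finset.sum_congr rfl fun p _ => ?_
    unfold keepsDescents
    ring
  rw [Finset.sum_congr rfl hsplit, Finset.sum_add_distrib, Finset.sum_add_distrib,
    ← Finset.sum_mul, sum_descents_word hm, Finset.sum_comm]
  have hzero : ∀ p ∈ range (m + 1), ∑ q ∈ range (m + 1),
      (if word w (p + 1) < word w p then 1 else 0 : ℤ) *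
        ((if word w⁻¹ q ≤ p then 1 else 0) - (if word w⁻¹ (q + 1) ≤ p then 1 else 0)) = 0 := by
    intro p _
    rw [← Finset.mul_sum,
      Finset.sum_range_sub' (fun q => (if word w⁻¹ q ≤ p then 1 else 0 : ℤ)), word_zero,
      word_of_lt _ (Nat.lt_succ_self m)]
    simp
  rw [Finset.sum_eq_zero hzero, Finset.sum_sub_distrib]
  simp
  ring

lemma pow_eq_pow_mul_of_add_eq {R : Type*} [CommRing R] (x : R) {a b : ℕ} {f : ℤ}
    (hf : f = 0 ∨ f = 1) (h : (a : ℤ) + f = b + 1) :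
    x ^ (a + 1) = x ^ (b + 1) * (x + f * (1 - x)) := by
  rcases hf with rfl | rfl
  · obtain rfl : a = b + 1 := by omega
    push_cast
    ring
  · obtain rfl : a = b := by omega
    push_cast
    ring

lemma sum_insertPerm {R : Type*} [CommRing R] (x y : R) {m : ℕ} (hm : 1 ≤ m)
    (w : Equiv.Perm (Fin m)) :
    ∑ p : Fin (m + 1), ∑ q : Fin (m + 1),
      x ^ (des (insertPerm p q w)⁻¹ + 1) *
        y ^ (des (insertPerm p q w) + 1) =
      x ^ (des w⁻¹ + 1) * y ^ (des w + 1) *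
        ((m + 1) ^ 2 * x * y + (m + 1) * (des w + 1) * x * (1 - y) +
          (m + 1) * (des w⁻¹ + 1) * y * (1 - x) +
          ((des w + 1) * (des w⁻¹ + 1) + m) * (1 - x) * (1 - y)) := by
  have hterm : ∀ p q : Fin (m + 1),
      x ^ (des (insertPerm p q w)⁻¹ + 1) *
        y ^ (des (insertPerm p q w) + 1) =
      x ^ (des w⁻¹ + 1) * y ^ (des w + 1) *
        (x * y + ((keepsDescents (word w) p q : ℤ) : R) * (x * (1 - y)) +
          ((keepsDescents (word w⁻¹) q p : ℤ) : R) * (y * (1 - x)) +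
          ((keepsDescents (word w) p q * keepsDescents (word w⁻¹) q p : ℤ) : R) *
            ((1 - x) * (1 - y))) := by
    intro p q
    rw [insertPerm_inv, pow_eq_pow_mul_of_add_eq x (keepsDescents_eq_zero_or_one _ _ _)
      (des_insertPerm hm q p w⁻¹), pow_eq_pow_mul_of_add_eq y
      (keepsDescents_eq_zero_or_one _ _ _) (des_insertPerm hm p q w)]
    push_cast
    ring
  have h1 : ∑ p : Fin (m + 1), ∑ q : Fin (m + 1), keepsDescents (word w) p q =
      (m + 1) * (des w + 1) := by
    rw [Finset.sum_comm]
    have hq (q : Fin (m + 1)) := (Fin.sum_univ_eq_sum_range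
      (fun p => keepsDescents (word w) p q) (m + 1)).trans (sum_keepsDescents hm w q)
    simp [hq]
  have h2 : ∑ p : Fin (m + 1), ∑ q : Fin (m + 1), keepsDescents (word w⁻¹) q p =
      (m + 1) * (des w⁻¹ + 1) := by
    have hp (p : Fin (m + 1)) := (Fin.sum_univ_eq_sum_range
      (fun q => keepsDescents (word w⁻¹) q p) (m + 1)).trans (sum_keepsDescents hm w⁻¹ p)
    simp [hp]
  have h3 : ∑ p : Fin (m + 1), ∑ q : Fin (m + 1),
      keepsDescents (word w) p q * keepsDescents (word w⁻¹) q p =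
      (des w + 1) * (des w⁻¹ + 1) + m := by
    rw [← sum_keepsDescents_mul hm, Finset.sum_comm, ← Fin.sum_univ_eq_sum_range (fun q =>
      ∑ p ∈ range (m + 1), keepsDescents (word w) p q * keepsDescents (word w⁻¹) q p)]
    refine Finset.sum_congr rfl fun q _ => ?_
    exact Fin.sum_univ_eq_sum_range
      (fun p => keepsDescents (word w) p q * keepsDescents (word w⁻¹) q p) _
  simp_rw [hterm, ← Finset.mul_sum, Finset.sum_add_distrib, ← Finset.sum_mul, ← Int.cast_sum,
    h1, h2, h3]
  simp
  ring

open MvPolynomial in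
lemma card_mul_twoSidedEulerianPoly_succ (m : ℕ) :
    ((m + 1 : ℕ) : MvPolynomial (Fin 2) ℤ) * twoSidedEulerianPoly (m + 1) =
      ∑ w : Equiv.Perm (Fin m), ∑ p : Fin (m + 1), ∑ q : Fin (m + 1),
        (X 0 : MvPolynomial (Fin 2) ℤ) ^ (des (insertPerm p q w)⁻¹ + 1) *
          X 1 ^ (des (insertPerm p q w) + 1) := by
  rw [Finset.sum_comm]
  have h : ∀ p : Fin (m + 1), ∑ w : Equiv.Perm (Fin m), ∑ q : Fin (m + 1),
      (X 0 : MvPolynomial (Fin 2) ℤ) ^ (des (insertPerm p q w)⁻¹ + 1) *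
        X 1 ^ (des (insertPerm p q w) + 1) = twoSidedEulerianPoly (m + 1) := by
    intro p
    rw [Finset.sum_comm, ← Fintype.sum_prod_type', twoSidedEulerianPoly]
    exact (insertPerm_bijective p).sum_comp fun v : Equiv.Perm (Fin (m + 1)) =>
      (X 0 : MvPolynomial (Fin 2) ℤ) ^ (des v⁻¹ + 1) * X 1 ^ (des v + 1)
  simp [h]

open MvPolynomial in
/-- The partial differential recurrence for the two-sided Eulerian
polynomials:
`n A_n = (n² s t + (n-1)(1-s)(1-t)) A_{n-1} + n s t (1-s) ∂A_{n-1}/∂s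
  + n s t (1-t) ∂A_{n-1}/∂t + s t (1-s)(1-t) ∂²A_{n-1}/∂s∂t`. -/
theorem twoSidedEulerianPoly_recurrence (n : ℕ) (hn : 2 ≤ n) :
    (n : MvPolynomial (Fin 2) ℤ) * twoSidedEulerianPoly n =
      ((n : MvPolynomial (Fin 2) ℤ) ^ 2 * X 0 * X 1 +
          ((n : MvPolynomial (Fin 2) ℤ) - 1) * (1 - X 0) * (1 - X 1)) *
        twoSidedEulerianPoly (n - 1) +
      (n : MvPolynomial (Fin 2) ℤ) * X 0 * X 1 * (1 - X 0) *
        pderiv 0 (twoSidedEulerianPoly (n - 1)) +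
      (n : MvPolynomial (Fin 2) ℤ) * X 0 * X 1 * (1 - X 1) *
        pderiv 1 (twoSidedEulerianPoly (n - 1)) +
      X 0 * X 1 * (1 - X 0) * (1 - X 1) *
        pderiv 0 (pderiv 1 (twoSidedEulerianPoly (n - 1))) := by
  obtain ⟨m, rfl⟩ : ∃ m, n = m + 1 := ⟨n - 1, by omega⟩
  rw [card_mul_twoSidedEulerianPoly_succ, Nat.add_sub_cancel, twoSidedEulerianPoly]
  simp only [map_sum, Finset.mul_sum, ← Finset.sum_add_distrib]
  refine Finset.sum_congr rfl fun w _ => ?_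
  rw [sum_insertPerm (X 0) (X 1) (by omega)]
  simp [Derivation.leibniz, Derivation.leibniz_pow, pderiv_X]
  ring
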